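/- Let (Q,P) be a weakly quasi-lattice ordered group and let Λ be a P-graph with FA(Λ) ≠ ∅, and set FAr(Λ) = FA(Λ) ∪ r(FA(Λ)). Then FAr(Λ) is a subcategory of Λ (it is closed under composition and under the source and range maps), and the pair (FAr(Λ),Λ) is a finitely aligned relative category of paths: (i) for every μ,ν ∈ FAr(Λ) there is a finite J ⊆ FAr(Λ) with μΛ ∩ νΛ = ⋃_{λ∈J} λΛ, and (ii) for every μ ∈ FAr(Λ), μΛ ∩ FAr(Λ) = μ·FAr(Λ). -/

import Mathlib

set_option autoImplicit false

/-- The topology on the power set `Set α` obtained by identifying it with the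
product `∏ _ : α, Prop` where each (two-point) factor `Prop` carries the
discrete topology. -/
instance powersetTopology (α : Type) : TopologicalSpace (Set α) :=
  @Pi.topologicalSpace α (fun _ => Prop) (fun _ => ⊥)

/-- The cylinder `Z(K₁;K₂) = {x : K₁ ⊆ x ⊆ K₂ᶜ}`. -/
def cylinder {α : Type} (K₁ K₂ : Set α) : Set (Set α) :=
  {x | K₁ ⊆ x ∧ x ⊆ K₂ᶜ}

/-- The relation `p ≤ r` iff `p * q = r` for some `q ∈ P`. -/
def Submonoid.leftLE {Q : Type} [Group Q] (P : Submonoid Q) (p r : Q) : Prop :=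
  ∃ q ∈ P, p * q = r

/-- A weakly quasi-lattice ordered group `(Q,P)`: a group `Q` together with a
subsemigroup `P` containing the unit with `P ∩ P⁻¹ = {e}`, such that any two
elements of `P` with a common upper bound (for `leftLE`) have a least common
upper bound. -/
structure WQLO (Q : Type) [Group Q] where
  P : Submonoid Q
  inter_inv : ∀ p ∈ P, p⁻¹ ∈ P → p = 1
  lub : ∀ a ∈ P, ∀ b ∈ P, (∃ c ∈ P, P.leftLE a c ∧ P.leftLE b c) →
    ∃ l ∈ P, P.leftLE a l ∧ P.leftLE b l ∧
      ∀ c ∈ P, P.leftLE a c → P.leftLE b c → P.leftLE l c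

/-- A (discrete) `P`-graph: a countable small category, presented by its set of
morphisms `Λ` with range map `r`, source map `s` and a composition `mul`
(constrained by the axioms only on composable pairs, i.e. when `s μ = r ν`),
together with a degree functor `d : Λ → P` satisfying the unique factorisation
property. The units of `Λ` are exactly the elements of the form `r lam`. -/
structure PGraph (Q : Type) [Group Q] (W : WQLO Q) where
  Λ : Type
  countable : Countable Λ
  r : Λ → Λ
  s : Λ → Λ
  mul : Λ → Λ → Λ
  d : Λ → Q
  d_mem : ∀ lam, d lam ∈ W.P
  s_r : ∀ lam, s (r lam) = r lam
  r_r : ∀ lam, r (r lam) = r lam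
  s_s : ∀ lam, s (s lam) = s lam
  r_s : ∀ lam, r (s lam) = s lam
  id_mul : ∀ lam, mul (r lam) lam = lam
  mul_id : ∀ lam, mul lam (s lam) = lam
  r_mul : ∀ mu nu, s mu = r nu → r (mul mu nu) = r mu
  s_mul : ∀ mu nu, s mu = r nu → s (mul mu nu) = s nu
  mul_assoc : ∀ mu nu k, s mu = r nu → s nu = r k →
    mul (mul mu nu) k = mul mu (mul nu k)
  d_unit : ∀ lam, d (r lam) = 1
  d_mul : ∀ mu nu, s mu = r nu → d (mul mu nu) = d mu * d nu
  factor : ∀ lam, ∀ p ∈ W.P, ∀ q ∈ W.P, d lam = p * q →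
    ∃! mn : Λ × Λ, s mn.1 = r mn.2 ∧ mul mn.1 mn.2 = lam ∧ d mn.1 = p ∧ d mn.2 = q

namespace PGraph

variable {Q : Type} [Group Q] {W : WQLO Q} (G : PGraph Q W)

/-- `λΛ = {λμ : μ ∈ Λ, s λ = r μ}`. -/
def cone (lam : G.Λ) : Set G.Λ :=
  {x | ∃ mu, G.s lam = G.r mu ∧ x = G.mul lam mu}

/-- `λE = {λμ : μ ∈ E, s λ = r μ}`. -/
def coneSet (lam : G.Λ) (E : Set G.Λ) : Set G.Λ :=
  {x | ∃ mu ∈ E, G.s lam = G.r mu ∧ x = G.mul lam mu}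

/-- `Λ` is finitely aligned at the pair `(μ,ν)`. -/
def FinAlignedAtPair (mu nu : G.Λ) : Prop :=
  ∃ J : Finset G.Λ, G.cone mu ∩ G.cone nu = ⋃ lam ∈ (J : Set G.Λ), G.cone lam

/-- `Λ` is finitely aligned at `λ`. -/
def FinAlignedAt (lam : G.Λ) : Prop :=
  ∀ mu ∈ G.cone lam, ∀ nu : G.Λ, G.FinAlignedAtPair mu nu

/-- The finitely aligned part `FA(Λ)`. -/
def FA : Set G.Λ := {lam | G.FinAlignedAt lam}

/-- `FAr(Λ) = FA(Λ) ∪ r(FA(Λ))`. -/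
def FAr : Set G.Λ := G.FA ∪ G.r '' G.FA

/-- `μ ≼ λ` iff `μν = λ` for some `ν`. -/
def pre (mu lam : G.Λ) : Prop :=
  ∃ nu, G.s mu = G.r nu ∧ G.mul mu nu = lam

/-- A filter: a nonempty, hereditary and directed subset of `Λ`. -/
def IsFilter (x : Set G.Λ) : Prop :=
  x.Nonempty ∧ (∀ lam mu, G.pre lam mu → mu ∈ x → lam ∈ x) ∧
    ∀ mu ∈ x, ∀ nu ∈ x, ∃ lam ∈ x, G.pre mu lam ∧ G.pre nu lam

/-- The space `ℱΛ` of filters, with the subspace topology from `𝒫(Λ)`. -/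
abbrev FilterSpace := {x : Set G.Λ // G.IsFilter x}

/-- `Z_{ℱΛ}(μ;K) = {x ∈ ℱΛ : μ ∈ x ⊆ Λ∖K}`. -/
def Zf (mu : G.Λ) (K : Set G.Λ) : Set G.FilterSpace :=
  {x | mu ∈ x.1 ∧ x.1 ⊆ Kᶜ}

/-- An ultrafilter: a filter maximal with respect to inclusion. -/
def IsUltrafilter (x : Set G.Λ) : Prop :=
  G.IsFilter x ∧ ∀ y, G.IsFilter y → x ⊆ y → x = y

/-- The path space `PS(Λ)`: filters meeting `FA(Λ)` (as a set of subsets). -/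
def PS : Set (Set G.Λ) := {x | G.IsFilter x ∧ (x ∩ G.FA).Nonempty}

/-- The path space as a topological space (subspace of `𝒫(Λ)`). -/
abbrev PSpace := {x : Set G.Λ // x ∈ G.PS}

/-- The boundary-path space: the closure in `PS(Λ)` of the set of ultrafilters
lying in `PS(Λ)`. -/
def BPS : Set G.PSpace := closure {x : G.PSpace | G.IsUltrafilter x.1}

abbrev BPSpace := {x : G.PSpace // x ∈ G.BPS}

/-- The left shift `λ⁻¹·x = {μ : λμ ∈ x}`. -/
def lshift (lam : G.Λ) (x : Set G.Λ) : Set G.Λ :=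
  {mu | G.s lam = G.r mu ∧ G.mul lam mu ∈ x}

/-- The right shift `λ·x = {ζ : ζ ≼ λμ for some μ ∈ x}`. -/
def rshift (lam : G.Λ) (x : Set G.Λ) : Set G.Λ :=
  {z | ∃ mu ∈ x, G.s lam = G.r mu ∧ G.pre z (G.mul lam mu)}

/-- The action `x·m`: the left shift of `x` by the unique element of
`x ∩ Λ^m` (when it exists). -/
def act (x : Set G.Λ) (m : Q) : Set G.Λ :=
  ⋃ lam ∈ {l ∈ x | G.d l = m}, G.lshift lam x

/-- The domain `D_m = {x ∈ PS(Λ) : x ∩ Λ^m ≠ ∅}` of `T_m`. -/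
def Dom (m : Q) : Set (Set G.Λ) := {x ∈ G.PS | ∃ l ∈ x, G.d l = m}

/-- The range `R_m = {x·m : x ∈ D_m}` of `T_m`. -/
def Ran (m : Q) : Set (Set G.Λ) := {y | ∃ x ∈ G.Dom m, G.act x m = y}

end PGraph

namespace PGraph

variable {Q : Type} [Group Q] {W : WQLO Q} (G : PGraph Q W)

theorem mul_left_cancel {a b c : G.Λ} (hb : G.s a = G.r b) (hc : G.s a = G.r c)
    (h : G.mul a b = G.mul a c) : b = c := by
  have hd : G.d b = G.d c := by
    have h' := congrArg G.d h
    rw [G.d_mul _ _ hb, G.d_mul _ _ hc] at h'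
    exact _root_.mul_left_cancel h'
  have hu := (G.factor (G.mul a b) _ (G.d_mem a) _ (G.d_mem b) (G.d_mul _ _ hb)).unique
    (y₁ := (a, b)) (y₂ := (a, c)) ⟨hb, rfl, rfl, rfl⟩ ⟨hc, h.symm, rfl, hd.symm⟩
  exact congrArg Prod.snd hu

theorem eq_r_of_d_eq_one {a : G.Λ} (h : G.d a = 1) : a = G.r a := by
  have hs : G.d (G.s a) = 1 := by
    rw [← G.r_s a]
    exact G.d_unit _
  have hu := (G.factor a 1 W.P.one_mem 1 W.P.one_mem (by simpa using h)).unique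
    (y₁ := (a, G.s a)) (y₂ := (G.r a, a)) ⟨(G.r_s a).symm, G.mul_id a, h, hs⟩
    ⟨G.s_r a, G.id_mul a, G.d_unit a, h⟩
  exact congrArg Prod.fst hu

theorem mem_cone_self (a : G.Λ) : a ∈ G.cone a :=
  ⟨G.s a, (G.r_s a).symm, (G.mul_id a).symm⟩

theorem cone_subset_cone {a b : G.Λ} (h : b ∈ G.cone a) : G.cone b ⊆ G.cone a := by
  rintro _ ⟨m, hm, rfl⟩
  obtain ⟨k, hk, rfl⟩ := h
  rw [G.s_mul _ _ hk] at hm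
  exact ⟨G.mul k m, by rw [G.r_mul _ _ hm, hk], G.mul_assoc _ _ _ hk hm⟩

theorem r_eq_of_mem_cone {a b : G.Λ} (h : b ∈ G.cone a) : G.r b = G.r a := by
  obtain ⟨k, hk, rfl⟩ := h
  exact G.r_mul _ _ hk

theorem mul_mem_cone_mul_iff {a b c : G.Λ} (hb : G.s a = G.r b) (hc : G.s a = G.r c) :
    G.mul a c ∈ G.cone (G.mul a b) ↔ c ∈ G.cone b := by
  constructor
  · rintro ⟨m, hm, h⟩
    rw [G.s_mul _ _ hb] at hm
    rw [G.mul_assoc _ _ _ hb hm] at h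
    exact ⟨m, hm, G.mul_left_cancel hc (by rw [G.r_mul _ _ hm, hb]) h⟩
  · rintro ⟨m, hm, rfl⟩
    exact ⟨m, by rw [G.s_mul _ _ hb, hm], (G.mul_assoc _ _ _ hb hm).symm⟩

theorem mem_cone_r {a b : G.Λ} : b ∈ G.cone (G.r a) ↔ G.r b = G.r a := by
  constructor
  · intro h
    rw [G.r_eq_of_mem_cone h, G.r_r]
  · intro h
    exact ⟨b, by rw [G.s_r, h], by rw [← h, G.id_mul]⟩

theorem FA_of_mem_cone {a b : G.Λ} (ha : a ∈ G.FA) (hb : b ∈ G.cone a) : b ∈ G.FA :=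
  fun mu hmu nu => ha mu (G.cone_subset_cone hb hmu) nu

theorem FinAlignedAtPair.of_mul {a mu nu : G.Λ} (hmu : G.s a = G.r mu) (hnu : G.s a = G.r nu)
    (h : G.FinAlignedAtPair (G.mul a mu) (G.mul a nu)) : G.FinAlignedAtPair mu nu := by
  classical
  obtain ⟨J, hJ⟩ := h
  have key : ∀ j ∈ J, ∃ k, G.s a = G.r k ∧ j = G.mul a k := by
    intro j hj
    have hmem : j ∈ G.cone (G.mul a mu) ∩ G.cone (G.mul a nu) := by
      rw [hJ]
      exact Set.mem_biUnion (Finset.mem_coe.2 hj) (G.mem_cone_self j)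
    exact G.cone_subset_cone ⟨mu, hmu, rfl⟩ hmem.1
  choose f hf hfe using key
  refine ⟨J.attach.image fun j => f j.1 j.2, ?_⟩
  ext x
  have hx : G.s a = G.r x → (x ∈ G.cone mu ∩ G.cone nu ↔
      ∃ j ∈ J, G.mul a x ∈ G.cone j) := by
    intro hx
    have h := Set.ext_iff.1 hJ (G.mul a x)
    simpa [G.mul_mem_cone_mul_iff hmu hx, G.mul_mem_cone_mul_iff hnu hx] using h
  constructor
  · intro h
    have hr : G.s a = G.r x := by rw [G.r_eq_of_mem_cone h.1, hmu]
    obtain ⟨j, hj, hjx⟩ := (hx hr).1 h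
    rw [hfe j hj, G.mul_mem_cone_mul_iff (hf j hj) hr] at hjx
    exact Set.mem_biUnion (Finset.mem_coe.2
      (Finset.mem_image.2 ⟨⟨j, hj⟩, Finset.mem_attach _ _, rfl⟩)) hjx
  · intro h
    obtain ⟨k, hk, hkx⟩ := Set.mem_iUnion₂.1 h
    obtain ⟨⟨j, hj⟩, -, rfl⟩ := Finset.mem_image.1 (Finset.mem_coe.1 hk)
    have hr : G.s a = G.r x := by rw [G.r_eq_of_mem_cone hkx]; exact hf j hj
    refine (hx hr).2 ⟨j, hj, ?_⟩
    rw [hfe j hj, G.mul_mem_cone_mul_iff (hf j hj) hr]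
    exact hkx

theorem FA_of_mul {a b : G.Λ} (hab : G.s a = G.r b) (h : G.mul a b ∈ G.FA) : b ∈ G.FA := by
  intro mu hmu nu
  have hr : G.s a = G.r mu := by rw [G.r_eq_of_mem_cone hmu, hab]
  by_cases hnu : G.s a = G.r nu
  · exact .of_mul G hr hnu (h _ ((G.mul_mem_cone_mul_iff hab hr).2 hmu) _)
  · refine ⟨∅, ?_⟩
    ext x
    simp only [Set.mem_inter_iff, Finset.coe_empty, Set.mem_empty_iff_false, Set.iUnion_of_empty,
      Set.iUnion_empty, iff_false]
    rintro ⟨h₁, h₂⟩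
    exact hnu (by rw [hr, ← G.r_eq_of_mem_cone h₁, G.r_eq_of_mem_cone h₂])

theorem s_mem_FA {a : G.Λ} (h : a ∈ G.FA) : G.s a ∈ G.FA :=
  G.FA_of_mul (G.r_s a).symm (by rwa [G.mul_id])

theorem s_mem_FAr {a : G.Λ} (h : a ∈ G.FAr) : G.s a ∈ G.FAr := by
  rcases h with h | ⟨b, hb, rfl⟩
  · exact .inl (G.s_mem_FA h)
  · exact .inr ⟨b, hb, (G.s_r b).symm⟩

theorem r_mem_FAr {a : G.Λ} (h : a ∈ G.FAr) : G.r a ∈ G.FAr := by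
  rcases h with h | ⟨b, hb, rfl⟩
  · exact .inr ⟨a, h, rfl⟩
  · exact .inr ⟨b, hb, (G.r_r b).symm⟩

theorem mul_mem_FAr {a b : G.Λ} (ha : a ∈ G.FAr) (hb : b ∈ G.FAr) (hab : G.s a = G.r b) :
    G.mul a b ∈ G.FAr := by
  rcases ha with ha | ⟨c, -, rfl⟩
  · exact .inl (G.FA_of_mem_cone ha ⟨b, hab, rfl⟩)
  · rw [G.s_r] at hab
    rwa [hab, G.id_mul]

theorem d_eq_one_of_mul_eq_r {a b c : G.Λ} (hab : G.s a = G.r b) (h : G.mul a b = G.r c) :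
    G.d b = 1 := by
  have hd : G.d a * G.d b = 1 := by rw [← G.d_mul _ _ hab, h, G.d_unit]
  refine W.inter_inv _ (G.d_mem b) ?_
  rw [← eq_inv_of_mul_eq_one_left hd]
  exact G.d_mem a

theorem right_mem_FAr_of_mul {a b : G.Λ} (ha : a ∈ G.FAr) (hab : G.s a = G.r b)
    (h : G.mul a b ∈ G.FAr) : b ∈ G.FAr := by
  rcases h with h | ⟨c, -, h⟩
  · exact .inl (G.FA_of_mul hab h)
  · rw [G.eq_r_of_d_eq_one (G.d_eq_one_of_mul_eq_r hab h.symm), ← hab]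
    exact G.s_mem_FAr ha

theorem exists_finset_subset_FAr {mu nu : G.Λ} (hmu : mu ∈ G.FAr) (hnu : nu ∈ G.FAr) :
    ∃ J : Finset G.Λ, (J : Set G.Λ) ⊆ G.FAr ∧
      G.cone mu ∩ G.cone nu = ⋃ lam ∈ (J : Set G.Λ), G.cone lam := by
  rcases hmu with hmu | ⟨c, -, rfl⟩
  · obtain ⟨J, hJ⟩ := hmu mu (G.mem_cone_self mu) nu
    refine ⟨J, fun j hj => .inl (G.FA_of_mem_cone hmu ?_), hJ⟩
    have hmem : j ∈ G.cone mu ∩ G.cone nu := by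
      rw [hJ]
      exact Set.mem_biUnion hj (G.mem_cone_self j)
    exact hmem.1
  · by_cases h : G.r nu = G.r c
    · refine ⟨{nu}, by simpa using hnu, ?_⟩
      simpa using G.cone_subset_cone (G.mem_cone_r.2 h)
    · refine ⟨∅, by simp, ?_⟩
      ext x
      simp only [Set.mem_inter_iff, Finset.coe_empty, Set.mem_empty_iff_false,
        Set.iUnion_of_empty, Set.iUnion_empty, iff_false]
      rintro ⟨h₁, h₂⟩
      exact h (by rw [← G.r_eq_of_mem_cone h₂, G.mem_cone_r.1 h₁])

theorem cone_inter_FAr {mu : G.Λ} (hmu : mu ∈ G.FAr) :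
    G.cone mu ∩ G.FAr = G.coneSet mu G.FAr := by
  ext x
  constructor
  · rintro ⟨⟨b, hb, rfl⟩, hx⟩
    exact ⟨b, G.right_mem_FAr_of_mul hmu hb hx, hb, rfl⟩
  · rintro ⟨b, hbF, hb, rfl⟩
    exact ⟨⟨b, hb, rfl⟩, G.mul_mem_FAr hmu hbF hb⟩

end PGraph

/-- `FAr(Λ) = FA(Λ) ∪ r(FA(Λ))` is a subcategory of `Λ` (closed under
composition, source and range), and `(FAr(Λ), Λ)` is a finitely aligned
relative category of paths. -/
theorem statement4 {Q : Type} [Group Q] {W : WQLO Q} (G : PGraph Q W)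
    (hne : G.FA.Nonempty) :
    (∀ mu ∈ G.FAr, ∀ nu ∈ G.FAr, G.s mu = G.r nu → G.mul mu nu ∈ G.FAr) ∧
    (∀ lam ∈ G.FAr, G.s lam ∈ G.FAr ∧ G.r lam ∈ G.FAr) ∧
    (∀ mu ∈ G.FAr, ∀ nu ∈ G.FAr, ∃ J : Finset G.Λ, (J : Set G.Λ) ⊆ G.FAr ∧
      G.cone mu ∩ G.cone nu = ⋃ lam ∈ (J : Set G.Λ), G.cone lam) ∧
    (∀ mu ∈ G.FAr, G.cone mu ∩ G.FAr = G.coneSet mu G.FAr) :=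
  ⟨fun _ hmu _ hnu h => G.mul_mem_FAr hmu hnu h,
    fun _ h => ⟨G.s_mem_FAr h, G.r_mem_FAr h⟩,
    fun _ hmu _ hnu => G.exists_finset_subset_FAr hmu hnu,
    fun _ hmu => G.cone_inter_FAr hmu⟩
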